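/- arXiv:math/0611214 — 2 statements merged into one kernel-verified Lean document; each statement's English description precedes it below -/
import Mathlib

section
/- Let Q=[A,B,C] be a real binary quadratic form with discriminant D=B²−4AC>0 and let z∈ℍ. Then (a) 2·φ(z,Q) = z − N_Q·z, where N_Q·z denotes the Möbius action of N_Q on z; and (b) for every g=[[a,b],[c,d]]∈SL(2,ℝ), both cz+d and c·(N_Q·z)+d are nonzero and φ(g·z, gQ) = φ(z,Q)/((cz+d)·(c·(N_Q·z)+d)). -/
open Complex

noncomputable section

/-- A real binary quadratic form `Q = [A,B,C]`, as a triple of coefficients. -/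
abbrev QF : Type := ℝ × ℝ × ℝ

/-- The value `Q(z) = A z² + B z + C`. -/
def Qpoly (Q : QF) (z : ℂ) : ℂ := (Q.1 : ℂ) * z ^ 2 + (Q.2.1 : ℂ) * z + (Q.2.2 : ℂ)

/-- The derivative `Q'(z) = 2 A z + B`. -/
def Qderiv (Q : QF) (z : ℂ) : ℂ := 2 * (Q.1 : ℂ) * z + (Q.2.1 : ℂ)

/-- `φ(z,Q) = Q(z)/Q'(z)`. -/
def phiQ (Q : QF) (z : ℂ) : ℂ := Qpoly Q z / Qderiv Q z

/-- The right action `Q|g` of `g = [[a,b],[c,d]]` on forms: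
`(Q|g)(x,y) = Q(ax+by, cx+dy)`. -/
def Qslash (Q : QF) (a b c d : ℝ) : QF :=
  (Q.1 * a ^ 2 + Q.2.1 * a * c + Q.2.2 * c ^ 2,
   2 * Q.1 * a * b + Q.2.1 * (a * d + b * c) + 2 * Q.2.2 * c * d,
   Q.1 * b ^ 2 + Q.2.1 * b * d + Q.2.2 * d ^ 2)

/-- The Möbius action of the matrix `N_Q = [[-B,-2C],[2A,B]]` on `z`. -/
def NQmoeb (Q : QF) (z : ℂ) : ℂ :=
  (-(Q.2.1 : ℂ) * z - 2 * (Q.2.2 : ℂ)) / (2 * (Q.1 : ℂ) * z + (Q.2.1 : ℂ))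

theorem real_linear_eq_zero {p q : ℝ} {z : ℂ} (hz : 0 < z.im) (h : (p : ℂ) * z + q = 0) :
    p = 0 ∧ q = 0 := by
  have him := congrArg Complex.im h
  have hp : p = 0 := by simpa [hz.ne'] using him
  subst hp
  exact ⟨rfl, by simpa using h⟩

theorem Qpoly_Qslash_moebius (Q : QF) {a b c d : ℝ} (h : a * d - b * c = 1) {z : ℂ}
    (hj : (c : ℂ) * z + d ≠ 0) :
    Qpoly (Qslash Q d (-b) (-c) a) (((a : ℂ) * z + b) / ((c : ℂ) * z + d)) =
      Qpoly Q z / ((c : ℂ) * z + d) ^ 2 := by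
  have h' : (a : ℂ) * d - b * c = 1 := by exact_mod_cast h
  simp only [Qpoly, Qslash]
  push_cast
  field_simp
  linear_combination (Q.1 * z ^ 2 + Q.2.1 * z + Q.2.2 : ℂ) * ((a : ℂ) * d - b * c + 1) * h'

theorem Qderiv_Qslash_moebius (Q : QF) {a b c d : ℝ} (h : a * d - b * c = 1) {z : ℂ}
    (hj : (c : ℂ) * z + d ≠ 0) :
    Qderiv (Qslash Q d (-b) (-c) a) (((a : ℂ) * z + b) / ((c : ℂ) * z + d)) =
      ((2 * Q.1 * d - Q.2.1 * c) * z + (Q.2.1 * d - 2 * Q.2.2 * c)) / ((c : ℂ) * z + d) := by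
  have h' : (a : ℂ) * d - b * c = 1 := by exact_mod_cast h
  simp only [Qderiv, Qslash]
  push_cast
  field_simp
  linear_combination
    ((2 * Q.1 * d - Q.2.1 * c) * z + (Q.2.1 * d - 2 * Q.2.2 * c) : ℂ) * h'

theorem Qderiv_ne_zero {A B C : ℝ} (hD : 0 < B ^ 2 - 4 * A * C) {z : ℂ} (hz : 0 < z.im) :
    Qderiv (A, B, C) z ≠ 0 := by
  intro h
  obtain ⟨hA, rfl⟩ := real_linear_eq_zero (p := 2 * A) (q := B) hz
    (by simpa [Qderiv] using h)
  obtain rfl : A = 0 := by linarith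
  simp at hD

/-- Let `Q = [A,B,C]` have discriminant `B² - 4AC > 0` and
let `z ∈ ℍ`.  Then (a) `2·φ(z,Q) = z − N_Q·z`; and (b) for every
`g = [[a,b],[c,d]] ∈ SL(2,ℝ)` (so `gQ = Q|g⁻¹` with `g⁻¹ = [[d,-b],[-c,a]]`
and `g·z = (az+b)/(cz+d)`), both `cz+d` and `c·(N_Q·z)+d` are nonzero and
`φ(g·z, gQ) = φ(z,Q) / ((cz+d)·(c·(N_Q·z)+d))`. -/
theorem two_phi_and_cocycle (A B C : ℝ) (hD : 0 < B ^ 2 - 4 * A * C)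
    (z : ℂ) (hz : 0 < z.im) :
    2 * phiQ (A, B, C) z = z - NQmoeb (A, B, C) z ∧
    ∀ a b c d : ℝ, a * d - b * c = 1 →
      (c : ℂ) * z + d ≠ 0 ∧
      (c : ℂ) * NQmoeb (A, B, C) z + d ≠ 0 ∧
      phiQ (Qslash (A, B, C) d (-b) (-c) a) (((a : ℂ) * z + b) / ((c : ℂ) * z + d)) =
        phiQ (A, B, C) z / (((c : ℂ) * z + d) * ((c : ℂ) * NQmoeb (A, B, C) z + d)) := by
  have hQ := Qderiv_ne_zero hD hz
  have hN (c d : ℝ) : (c : ℂ) * NQmoeb (A, B, C) z + d =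
      ((2 * A * d - B * c) * z + (B * d - 2 * C * c)) / Qderiv (A, B, C) z := by
    rw [eq_div_iff hQ, add_mul, mul_assoc, NQmoeb, ← Qderiv.eq_1 (A, B, C) z,
      div_mul_cancel₀ _ hQ, Qderiv]
    ring
  refine ⟨?_, fun a b c d h => ?_⟩
  · rw [phiQ, NQmoeb, ← Qderiv.eq_1 (A, B, C) z, mul_div_assoc', eq_sub_iff_add_eq, ← add_div,
      div_eq_iff hQ, Qpoly, Qderiv]
    ring
  have hj : (c : ℂ) * z + d ≠ 0 := by
    intro h0
    obtain ⟨rfl, rfl⟩ := real_linear_eq_zero hz h0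
    simp at h
  have hW : ((2 * A * d - B * c) * z + (B * d - 2 * C * c) : ℂ) ≠ 0 := by
    intro h0
    obtain ⟨h1, h2⟩ := real_linear_eq_zero (p := 2 * A * d - B * c) (q := B * d - 2 * C * c) hz
      (by exact_mod_cast h0)
    have hc : (B ^ 2 - 4 * A * C) * c = 0 := by linear_combination 2 * A * h2 - B * h1
    have hd : (B ^ 2 - 4 * A * C) * d = 0 := by linear_combination B * h2 - 2 * C * h1
    obtain rfl := (mul_eq_zero.mp hc).resolve_left hD.ne'
    obtain rfl := (mul_eq_zero.mp hd).resolve_left hD.ne'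
    simp at h
  refine ⟨hj, ?_, ?_⟩
  · rw [hN]
    exact div_ne_zero hW hQ
  · rw [hN, phiQ, phiQ, Qpoly_Qslash_moebius _ h hj, Qderiv_Qslash_moebius _ h hj]
    field_simp
end
end

section
/- Let Q=[A,B,C] be a real binary quadratic form with discriminant D=B²−4AC>0, let Ψ be as in the context, and let z₀∈ℍ. If γ₁,γ₂∈SL(2,ℤ) both satisfy γᵢQ=Q, then Int(Q,γ₁γ₂;z₀) = Int(Q,γ₁;z₀) + Int(Q,γ₂;z₀). -/
open Complex

noncomputable section

/-- Discriminant `D = B² - 4AC`. -/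
def disc (Q : QF) : ℝ := Q.2.1 ^ 2 - 4 * Q.1 * Q.2.2

abbrev SL2Z := Matrix.SpecialLinearGroup (Fin 2) ℤ

/-- `Q|g` for an integral matrix `g ∈ SL(2,ℤ)`. -/
def QslashZ (Q : QF) (g : SL2Z) : QF :=
  Qslash Q ((g.1 0 0 : ℤ) : ℝ) ((g.1 0 1 : ℤ) : ℝ) ((g.1 1 0 : ℤ) : ℝ) ((g.1 1 1 : ℤ) : ℝ)

/-- The left action `gQ := Q|g⁻¹`. -/
def QAct (g : SL2Z) (Q : QF) : QF := QslashZ Q g⁻¹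

/-- The Möbius action `g·z = (az+b)/(cz+d)` of `g ∈ SL(2,ℤ)` on `z ∈ ℂ`. -/
def moebZ (g : SL2Z) (z : ℂ) : ℂ :=
  (((g.1 0 0 : ℤ) : ℂ) * z + ((g.1 0 1 : ℤ) : ℂ)) /
    (((g.1 1 0 : ℤ) : ℂ) * z + ((g.1 1 1 : ℤ) : ℂ))

/-- The hyperbolic period `Int(Q,γ;z₀) = ∫_{z₀}^{γz₀} Ψ(z,Q) dz/Q(z)`, the
integral being taken over the straight segment `σ(t) = z₀ + t(γz₀ − z₀)`,
`t ∈ [0,1]` (legitimate since `Q` has only real zeros and `ℍ` is convex). -/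
def IntQ (Ψ : QF → ℂ → ℂ) (Q : QF) (γ : SL2Z) (z₀ : ℂ) : ℂ :=
  ∫ t in (0:ℝ)..1,
    Ψ Q (z₀ + (t : ℂ) * (moebZ γ z₀ - z₀)) * (moebZ γ z₀ - z₀) /
      Qpoly Q (z₀ + (t : ℂ) * (moebZ γ z₀ - z₀))

lemma det_eq_one {R : Type*} [CommRing R] (g : SL2Z) :
    ((g.1 0 0 : ℤ) : R) * ((g.1 1 1 : ℤ) : R) - ((g.1 0 1 : ℤ) : R) * ((g.1 1 0 : ℤ) : R) = 1 := by
  have h := g.det_coe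
  rw [Matrix.det_fin_two] at h
  exact_mod_cast congrArg (Int.cast : ℤ → R) h

lemma moebZ_denom_ne_zero (g : SL2Z) {z : ℂ} (hz : 0 < z.im) :
    ((g.1 1 0 : ℤ) : ℂ) * z + ((g.1 1 1 : ℤ) : ℂ) ≠ 0 := by
  intro h
  have him := congrArg Complex.im h
  simp only [add_im, mul_im, intCast_re, intCast_im, zero_mul, add_zero, zero_im,
    mul_eq_zero, hz.ne', or_false] at him
  have hc : ((g.1 1 0 : ℤ) : ℂ) = 0 := by exact_mod_cast him
  have hd : ((g.1 1 1 : ℤ) : ℂ) = 0 := by simpa [hc] using h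
  simpa [hc, hd] using det_eq_one (R := ℂ) g

lemma moebZ_im_pos (g : SL2Z) {z : ℂ} (hz : 0 < z.im) : 0 < (moebZ g z).im := by
  have hne := normSq_pos.mpr (moebZ_denom_ne_zero g hz)
  have him : (moebZ g z).im =
      z.im / normSq (((g.1 1 0 : ℤ) : ℂ) * z + ((g.1 1 1 : ℤ) : ℂ)) := by
    rw [moebZ, div_im, ← sub_div]
    congr 1
    simp only [add_im, add_re, mul_im, mul_re, intCast_re, intCast_im]
    linear_combination z.im * det_eq_one (R := ℝ) g
  rw [him]
  positivity

lemma moebZ_mul (g h : SL2Z) {z : ℂ} (hz : 0 < z.im) :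
    moebZ (g * h) z = moebZ g (moebZ h z) := by
  have h1 := moebZ_denom_ne_zero h hz
  have h2 := moebZ_denom_ne_zero (g * h) hz
  have h3 := moebZ_denom_ne_zero g (moebZ_im_pos h hz)
  unfold moebZ at h3 ⊢
  rw [div_eq_div_iff h2 h3]
  simp only [Matrix.SpecialLinearGroup.coe_mul, Matrix.mul_apply, Fin.sum_univ_two,
    Int.cast_add, Int.cast_mul]
  field_simp
  ring

lemma hasDerivAt_moebZ (g : SL2Z) {z : ℂ} (hz : 0 < z.im) :
    HasDerivAt (moebZ g) (1 / (((g.1 1 0 : ℤ) : ℂ) * z + ((g.1 1 1 : ℤ) : ℂ)) ^ 2) z := by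
  have hne := moebZ_denom_ne_zero g hz
  have hlin (a b : ℂ) : HasDerivAt (fun w : ℂ => a * w + b) a z := by
    simpa using ((hasDerivAt_id z).const_mul a).add_const b
  refine ((hlin _ _).div (hlin _ _) hne).congr_deriv ?_
  congr 1
  linear_combination det_eq_one (R := ℂ) g

lemma QslashZ_eq_self {g : SL2Z} {Q : QF} (h : QAct g Q = Q) : QslashZ Q g = Q := by
  nth_rewrite 1 [← h]
  have hdet := det_eq_one (R := ℝ) g
  obtain ⟨A, B, C⟩ := Q
  simp only [QAct, QslashZ, Qslash, Matrix.SpecialLinearGroup.SL2_inv_expl]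
  simp only [Matrix.cons_val_zero, Matrix.cons_val_one, Matrix.cons_val',
    Matrix.cons_val_fin_one, Int.cast_neg, Prod.mk.injEq]
  generalize ((g.1 0 0 : ℤ) : ℝ) = a at *
  generalize ((g.1 0 1 : ℤ) : ℝ) = b at *
  generalize ((g.1 1 0 : ℤ) : ℝ) = c at *
  generalize ((g.1 1 1 : ℤ) : ℝ) = d at *
  refine ⟨?_, ?_, ?_⟩
  · linear_combination A * (a * d - b * c + 1) * hdet
  · linear_combination B * (a * d - b * c + 1) * hdet
  · linear_combination C * (a * d - b * c + 1) * hdet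

lemma Qpoly_moebZ (Q : QF) (g : SL2Z) {z : ℂ} (hz : 0 < z.im) :
    Qpoly Q (moebZ g z) =
      Qpoly (QslashZ Q g) z / (((g.1 1 0 : ℤ) : ℂ) * z + ((g.1 1 1 : ℤ) : ℂ)) ^ 2 := by
  have hne := moebZ_denom_ne_zero g hz
  have hw : moebZ g z * (((g.1 1 0 : ℤ) : ℂ) * z + ((g.1 1 1 : ℤ) : ℂ)) =
      ((g.1 0 0 : ℤ) : ℂ) * z + ((g.1 0 1 : ℤ) : ℂ) := div_mul_cancel₀ _ hne
  rw [eq_div_iff (pow_ne_zero 2 hne)]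
  generalize moebZ g z = w at *
  simp only [Qpoly, QslashZ, Qslash]
  push_cast
  generalize ((g.1 0 0 : ℤ) : ℂ) = a at *
  generalize ((g.1 0 1 : ℤ) : ℂ) = b at *
  generalize ((g.1 1 0 : ℤ) : ℂ) = c at *
  generalize ((g.1 1 1 : ℤ) : ℂ) = d at *
  linear_combination
    (Q.1 * (w * (c * z + d) + (a * z + b)) + Q.2.1 * (c * z + d)) * hw

lemma Qpoly_ne_zero {Q : QF} (hD : 0 < disc Q) {z : ℂ} (hz : 0 < z.im) : Qpoly Q z ≠ 0 := by
  obtain ⟨A, B, C⟩ := Q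
  intro h
  have hre := congrArg Complex.re h
  have him := congrArg Complex.im h
  simp only [Qpoly, pow_two, add_re, add_im, mul_re, mul_im, ofReal_re, ofReal_im, zero_mul,
    sub_zero, add_zero, zero_re, zero_im] at hre him
  simp only [disc] at hD
  have hB : B = -(2 * A * z.re) := by
    apply mul_right_cancel₀ hz.ne'
    linear_combination him
  have hdisc : B ^ 2 - 4 * A * C = -(4 * (A * z.im) ^ 2) := by
    subst hB
    linear_combination (-4 * A) * hre
  nlinarith [sq_nonneg (A * z.im)]

lemma convex_im_pos : Convex ℝ {z : ℂ | 0 < z.im} := convex_halfSpace_im_gt 0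

lemma isOpen_im_pos : IsOpen {z : ℂ | 0 < z.im} := isOpen_lt continuous_const continuous_im

/-- The integral along a segment in an open convex set is the difference of the values of a
primitive at the endpoints. -/
lemma integral_segment_eq_sub {f F : ℂ → ℂ} {s : Set ℂ} (hs : Convex ℝ s)
    (hf : ContinuousOn f s) (hF : ∀ z ∈ s, HasDerivAt F (f z) z) {z w : ℂ}
    (hz : z ∈ s) (hw : w ∈ s) :
    ∫ t in (0:ℝ)..1, f (z + (t : ℂ) * (w - z)) * (w - z) = F w - F z := by
  have hmem : ∀ t ∈ Set.uIcc (0:ℝ) 1, z + (t : ℂ) * (w - z) ∈ s := by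
    intro t ht
    rw [Set.uIcc_of_le zero_le_one] at ht
    simpa using hs.add_smul_sub_mem hz hw ht
  have hderiv : ∀ t ∈ Set.uIcc (0:ℝ) 1, HasDerivAt (fun t : ℝ => F (z + (t : ℂ) * (w - z)))
      (f (z + (t : ℂ) * (w - z)) * (w - z)) t := by
    intro t ht
    have hσ : HasDerivAt (fun t : ℝ => z + (t : ℂ) * (w - z)) (w - z) t := by
      simpa using ((hasDerivAt_id t).ofReal_comp.mul_const (w - z)).const_add z
    exact (hF _ (hmem t ht)).comp t hσ
  have hcont : ContinuousOn (fun t : ℝ => f (z + (t : ℂ) * (w - z)) * (w - z))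
      (Set.uIcc (0:ℝ) 1) :=
    (hf.comp (by fun_prop) hmem).mul continuousOn_const
  simpa using intervalIntegral.integral_eq_sub_of_hasDerivAt hderiv hcont.intervalIntegrable

/-- Let `Ψ` assign to every real quadratic form of positive
discriminant a holomorphic function on `ℍ` with `Ψ(g·z, gQ) = Ψ(z,Q)` for all
`g ∈ SL(2,ℤ)`.  If `Q` has positive discriminant, `z₀ ∈ ℍ`, and
`γ₁, γ₂ ∈ SL(2,ℤ)` both stabilize `Q`, then
`Int(Q,γ₁γ₂;z₀) = Int(Q,γ₁;z₀) + Int(Q,γ₂;z₀)`. -/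
theorem IntQ_additive (Ψ : QF → ℂ → ℂ)
    (hΨhol : ∀ Q : QF, 0 < disc Q →
      DifferentiableOn ℂ (Ψ Q) {z : ℂ | 0 < z.im})
    (hΨinv : ∀ Q : QF, 0 < disc Q → ∀ g : SL2Z, ∀ z : ℂ, 0 < z.im →
      Ψ (QAct g Q) (moebZ g z) = Ψ Q z)
    (Q : QF) (hD : 0 < disc Q) (z₀ : ℂ) (h₀ : 0 < z₀.im)
    (γ₁ γ₂ : SL2Z) (hγ₁ : QAct γ₁ Q = Q) (hγ₂ : QAct γ₂ Q = Q) :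
    IntQ Ψ Q (γ₁ * γ₂) z₀ = IntQ Ψ Q γ₁ z₀ + IntQ Ψ Q γ₂ z₀ := by
  have hol : DifferentiableOn ℂ (fun z => Ψ Q z / Qpoly Q z) {z : ℂ | 0 < z.im} :=
    (hΨhol Q hD).div (by unfold Qpoly; fun_prop) fun z hz => Qpoly_ne_zero hD hz
  obtain ⟨F, hF'⟩ := convex_im_pos.exists_forall_hasDerivWithinAt hol
  have hF : ∀ z ∈ {z : ℂ | 0 < z.im}, HasDerivAt F (Ψ Q z / Qpoly Q z) z :=
    fun z hz => (hF' z hz).hasDerivAt (isOpen_im_pos.mem_nhds hz)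
  have hInt (γ : SL2Z) : IntQ Ψ Q γ z₀ = F (moebZ γ z₀) - F z₀ := by
    rw [← integral_segment_eq_sub convex_im_pos hol.continuousOn hF h₀ (moebZ_im_pos γ h₀)]
    simp only [IntQ, div_mul_eq_mul_div]
  have hderiv : ∀ z ∈ {z : ℂ | 0 < z.im},
      HasDerivAt (fun z => F (moebZ γ₁ z) - F z) 0 z := by
    intro z hz
    have hcomp := (hF _ (moebZ_im_pos γ₁ hz)).comp z (hasDerivAt_moebZ γ₁ hz)
    refine (hcomp.sub (hF z hz)).congr_deriv ?_
    have hΨ := hΨinv Q hD γ₁ z hz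
    rw [hγ₁] at hΨ
    rw [hΨ, Qpoly_moebZ Q γ₁ hz, QslashZ_eq_self hγ₁, sub_eq_zero]
    have hne := moebZ_denom_ne_zero γ₁ hz
    have hQ := Qpoly_ne_zero hD hz
    field_simp
  have hconst : F (moebZ γ₁ (moebZ γ₂ z₀)) - F (moebZ γ₂ z₀) = F (moebZ γ₁ z₀) - F z₀ :=
    isOpen_im_pos.is_const_of_deriv_eq_zero convex_im_pos.isPreconnected
      (fun z hz => (hderiv z hz).differentiableAt.differentiableWithinAt)
      (fun z hz => (hderiv z hz).deriv) (moebZ_im_pos γ₂ h₀) h₀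
  rw [hInt, hInt, hInt, moebZ_mul γ₁ γ₂ h₀]
  linear_combination hconst
end
end
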